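/- (Sharpness of the integrability condition K ∈ L¹_loc; Ball's example.) Let f₀ : ℝ² → ℝ² be Ball's map: f₀(x,y) = (x, η(x,y)) where η(x,y) = |x|·y if |x| ≤ 1 and |y| ≤ 1; η(x,y) = (2(|y|−1) + |x|(2−|y|)) · sign(y) if |x| ≤ 1 and 1 ≤ |y| ≤ 2; and η(x,y) = y otherwise. Then f₀ is Lipschitz (hence differentiable almost everywhere with derivative Df₀), the fiber f₀⁻¹({(0,0)}) equals the nondegenerate segment {0} × [−1,1] (so f₀ is not discrete and not open), and: (i) there exists a measurable K : ℝ² → ℝ with K ≥ 1 everywhere, ‖Df₀(z)‖² ≤ K(z) · det Df₀(z) for almost every z ∈ ℝ², and ∫_A K(z)^p dz < ∞ for every compact A ⊆ ℝ² and every 0 < p < 1; yet (ii) every measurable K : ℝ² → ℝ satisfying ‖Df₀(z)‖² ≤ K(z) · det Df₀(z) for almost every z ∈ ℝ² has ∫_{(−1,1)×(−1,1)} K(z) dz = ∞. -/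

import Mathlib

open MeasureTheory Set
open scoped ENNReal NNReal Real Topology

noncomputable section

/-- The plane `ℝ²` as a Euclidean space. -/
abbrev E2 : Type := EuclideanSpace ℝ (Fin 2)

/-- The tent function: `y` on `[-1,1]`, decreasing to `0` at `|y| = 2`. -/
def tent (y : ℝ) : ℝ := 2 * max (-1) (min 1 y) - max (-2) (min 2 y)

/-- The cutoff `1 - min |x| 1`. -/
def cut (x : ℝ) : ℝ := 1 - min |x| 1

lemma eta_eq (x y : ℝ) : (if |x| ≤ 1 ∧ |y| ≤ 1 then |x| * y
      else if |x| ≤ 1 ∧ |y| ≤ 2 then (2 * (|y| - 1) + |x| * (2 - |y|)) * Real.sign y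
      else y) = y - cut x * tent y := by
  unfold cut tent
  by_cases hx : |x| ≤ 1
  · rw [min_eq_left hx]
    by_cases hy : |y| ≤ 1
    · obtain ⟨h1, h2⟩ := abs_le.1 hy
      rw [if_pos ⟨hx, hy⟩, min_eq_right h2, max_eq_right h1, min_eq_right (by linarith),
        max_eq_right (by linarith)]
      ring
    · rw [if_neg (by tauto)]
      push Not at hy
      rcases lt_abs.1 hy with h | h
      · rw [abs_of_pos (by linarith : 0 < y), Real.sign_of_pos (by linarith),
          min_eq_left h.le, max_eq_right (by norm_num : (-1 : ℝ) ≤ 1)]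
        by_cases h2 : y ≤ 2
        · rw [if_pos ⟨hx, h2⟩, min_eq_right h2, max_eq_right (by linarith)]; ring
        · push Not at h2
          rw [if_neg (by intro h; linarith [h.2]), min_eq_left h2.le, max_eq_right (by norm_num)]
          ring
      · rw [abs_of_neg (by linarith : y < 0), Real.sign_of_neg (by linarith),
          min_eq_right (by linarith : y ≤ 1), max_eq_left (by linarith : y ≤ -1),
          min_eq_right (by linarith : y ≤ 2)]
        by_cases h2 : -y ≤ 2
        · rw [if_pos ⟨hx, h2⟩, max_eq_right (by linarith)]; ring
        · push Not at h2
          rw [if_neg (by intro h; linarith [h.2]), max_eq_left (by linarith)]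
          ring
  · rw [if_neg (by tauto), if_neg (by tauto), min_eq_right (by linarith)]; ring

lemma cut_mem (x : ℝ) : 0 ≤ cut x ∧ cut x ≤ 1 := by
  unfold cut
  have := abs_nonneg x
  constructor
  · linarith [min_le_right |x| 1]
  · linarith [le_min this zero_le_one]

lemma tent_abs (y : ℝ) : |tent y| ≤ 1 := by
  unfold tent; rw [abs_le]; constructor <;> grind

lemma tent_lip (y z : ℝ) : |tent y - tent z| ≤ |y - z| := by
  unfold tent; grind

lemma cut_lip (y z : ℝ) : |cut y - cut z| ≤ |y - z| := by
  unfold cut; grind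

lemma eta_lip (x y x' y' : ℝ) :
    |(y - cut x * tent y) - (y' - cut x' * tent y')| ≤ 2 * |y - y'| + |x - x'| := by
  have e : (y - cut x * tent y) - (y' - cut x' * tent y') =
    (y - y') - cut x * (tent y - tent y') - (cut x - cut x') * tent y' := by ring
  have h1 : |cut x * (tent y - tent y')| ≤ |y - y'| := by
    rw [abs_mul, abs_of_nonneg (cut_mem x).1]
    nlinarith [tent_lip y y', (cut_mem x).1, (cut_mem x).2, abs_nonneg (tent y - tent y')]
  have h2 : |(cut x - cut x') * tent y'| ≤ |x - x'| := by
    rw [abs_mul]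
    nlinarith [cut_lip x x', tent_abs y', abs_nonneg (cut x - cut x'), abs_nonneg (tent y')]
  rw [e]
  rw [abs_le] at *
  have h3 := neg_abs_le (y - y')
  have h4 := le_abs_self (y - y')
  constructor <;> linarith [h1.1, h1.2, h2.1, h2.2]

lemma tent_deriv (y : ℝ) (h1 : y ≠ 1) (h2 : y ≠ -1) (h3 : y ≠ 2) (h4 : y ≠ -2) :
    ∃ d, HasDerivAt tent d y ∧ |d| ≤ 1 ∧ (|y| < 1 → d = 1) := by
  have key : ∀ (l u c d : ℝ), l < y → y < u → (∀ t, l < t → t < u → tent t = c + d * t) →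
      HasDerivAt tent d y := by
    intro l u c d hl hu h
    have : HasDerivAt (fun t : ℝ => c + d * t) d y := by
      simpa using ((hasDerivAt_id y).const_mul d).const_add c
    refine this.congr_of_eventuallyEq ?_
    filter_upwards [Ioo_mem_nhds hl hu] with t ht using h t ht.1 ht.2
  rcases lt_or_gt_of_ne h4 with h | h
  · refine ⟨0, key (y - 1) (-2) 0 0 (by linarith) h ?_, by simp, ?_⟩
    · intro t _ _; unfold tent; grind
    · grind
  rcases lt_or_gt_of_ne h2 with h' | h'
  · refine ⟨-1, key (-2) (-1) (-2) (-1) h h' ?_, by simp, ?_⟩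
    · intro t _ _; unfold tent; grind
    · grind
  rcases lt_or_gt_of_ne h1 with h'' | h''
  · refine ⟨1, key (-1) 1 0 1 h' h'' ?_, by simp, fun _ => rfl⟩
    · intro t _ _; unfold tent; grind
  rcases lt_or_gt_of_ne h3 with h5 | h5
  · refine ⟨-1, key 1 2 2 (-1) h'' h5 ?_, by simp, ?_⟩
    · intro t _ _; unfold tent; grind
    · grind
  · refine ⟨0, key 2 (y+1) 0 0 h5 (by linarith) ?_, by simp, ?_⟩
    · intro t _ _; unfold tent; grind
    · grind

lemma cut_deriv (y : ℝ) (h0 : y ≠ 0) (h1 : y ≠ 1) (h2 : y ≠ -1) :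
    ∃ d, HasDerivAt cut d y ∧ |d| ≤ 1 := by
  have key : ∀ (l u c d : ℝ), l < y → y < u → (∀ t, l < t → t < u → cut t = c + d * t) →
      HasDerivAt cut d y := by
    intro l u c d hl hu h
    have : HasDerivAt (fun t : ℝ => c + d * t) d y := by
      simpa using ((hasDerivAt_id y).const_mul d).const_add c
    refine this.congr_of_eventuallyEq ?_
    filter_upwards [Ioo_mem_nhds hl hu] with t ht using h t ht.1 ht.2
  rcases lt_or_gt_of_ne h2 with h' | h'
  · refine ⟨0, key (y-1) (-1) 0 0 (by linarith) h' ?_, by simp⟩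
    intro t _ _; unfold cut; grind
  rcases lt_or_gt_of_ne h0 with h | h
  · refine ⟨1, key (-1) 0 1 1 h' h ?_, by simp⟩
    intro t _ _; unfold cut; grind
  rcases lt_or_gt_of_ne h1 with h'' | h''
  · refine ⟨-1, key 0 1 1 (-1) h h'' ?_, by simp⟩
    intro t _ _; unfold cut; grind
  · refine ⟨0, key 1 (y+1) 0 0 h'' (by linarith) ?_, by simp⟩
    intro t _ _; unfold cut; grind

/-- The linear map with matrix `(1, 0; a, b)`. -/
def shear (a b : ℝ) : E2 →L[ℝ] E2 :=
  LinearMap.toContinuousLinearMap (Matrix.toLin (EuclideanSpace.basisFun (Fin 2) ℝ).toBasis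
    (EuclideanSpace.basisFun (Fin 2) ℝ).toBasis !![1, 0; a, b])

lemma shear_det (a b : ℝ) : (shear a b).det = b := by
  simp [shear, ContinuousLinearMap.det, LinearMap.det_toLin, Matrix.det_fin_two]

lemma shear_zero (a b : ℝ) (v : E2) : shear a b v 0 = v 0 := by
  simp [shear, Matrix.toLin_apply, Matrix.mulVec, dotProduct, Fin.sum_univ_two]

lemma shear_one (a b : ℝ) (v : E2) : shear a b v 1 = a * v 0 + b * v 1 := by
  simp [shear, Matrix.toLin_apply, Matrix.mulVec, dotProduct, Fin.sum_univ_two]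

lemma shear_norm_le (a b : ℝ) : ‖shear a b‖ ^ 2 ≤ 1 + a ^ 2 + b ^ 2 := by
  have h : ‖shear a b‖ ≤ √(1 + a ^ 2 + b ^ 2) := by
    refine ContinuousLinearMap.opNorm_le_bound _ (Real.sqrt_nonneg _) fun v => ?_
    rw [EuclideanSpace.norm_eq, EuclideanSpace.norm_eq, ← Real.sqrt_mul (by positivity)]
    apply Real.sqrt_le_sqrt
    simp only [Fin.sum_univ_two, shear_zero, shear_one, Real.norm_eq_abs, sq_abs]
    nlinarith [sq_nonneg (a * v 1 - b * v 0), sq_nonneg (v 1)]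
  calc _ ≤ √(1 + a ^ 2 + b ^ 2) ^ 2 := by gcongr
    _ = _ := Real.sq_sqrt (by positivity)

lemma one_le_shear_norm (a b : ℝ) : 1 ≤ ‖shear a b‖ := by
  have h := (shear a b).le_opNorm (EuclideanSpace.single 0 1)
  have h2 := PiLp.norm_apply_le (shear a b (EuclideanSpace.single 0 1)) 0
  rw [shear_zero] at h2
  simp at h h2
  linarith

/-- Normal form of Ball's map. -/
def ballMap (p : E2) : E2 :=
  (EuclideanSpace.equiv (Fin 2) ℝ).symm ![p 0, p 1 - cut (p 0) * tent (p 1)]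

lemma ballMap_zero (p : E2) : ballMap p 0 = p 0 := by simp [ballMap]
lemma ballMap_one (p : E2) : ballMap p 1 = p 1 - cut (p 0) * tent (p 1) := by simp [ballMap]

lemma ballMap_lip : LipschitzWith 4 ballMap := by
  refine LipschitzWith.of_dist_le_mul fun p q => ?_
  rw [EuclideanSpace.dist_eq, EuclideanSpace.dist_eq]
  simp only [Fin.sum_univ_two, ballMap_zero, ballMap_one, Real.dist_eq, sq_abs]
  have h := eta_lip (p 0) (p 1) (q 0) (q 1)
  have e : ((4 : ℝ≥0) : ℝ) = √(16) := by
    rw [show (16 : ℝ) = 4 ^ 2 by norm_num, Real.sqrt_sq (by norm_num)]; rfl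
  rw [e, ← Real.sqrt_mul (by norm_num)]
  apply Real.sqrt_le_sqrt
  have h' := pow_le_pow_left₀ (abs_nonneg _) h 2
  rw [sq_abs] at h'
  have e1 := sq_abs (p 0 - q 0)
  have e2 := sq_abs (p 1 - q 1)
  nlinarith [sq_nonneg (|p 0 - q 0| - |p 1 - q 1|), sq_nonneg (p 0 - q 0), sq_nonneg (p 1 - q 1)]

/-- The exceptional lines. -/
def good (z : E2) : Prop :=
  (z 0 ≠ 0 ∧ z 0 ≠ 1 ∧ z 0 ≠ -1) ∧ (z 1 ≠ 1 ∧ z 1 ≠ -1 ∧ z 1 ≠ 2 ∧ z 1 ≠ -2)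

lemma ae_ne (i : Fin 2) (c : ℝ) : ∀ᵐ z : E2, z i ≠ c := by
  have h := EuclideanSpace.volume_preserving_symm_measurableEquiv_toLp (Fin 2)
  have h2 : ∀ᵐ z : Fin 2 → ℝ, z i ≠ c := by
    rw [ae_iff]
    simp only [not_not]
    exact Measure.pi_hyperplane (fun _ : Fin 2 => (volume : Measure ℝ)) i c
  exact h.quasiMeasurePreserving.ae h2

lemma ae_good : ∀ᵐ z : E2, good z := by
  filter_upwards [ae_ne 0 0, ae_ne 0 1, ae_ne 0 (-1), ae_ne 1 1, ae_ne 1 (-1), ae_ne 1 2,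
    ae_ne 1 (-2)] with z h1 h2 h3 h4 h5 h6 h7
  exact ⟨⟨h1, h2, h3⟩, h4, h5, h6, h7⟩

lemma ballMap_deriv (z : E2) (hz : good z) : ∃ a b, HasFDerivAt ballMap (shear a b) z ∧
    |a| ≤ 1 ∧ b ≤ 2 ∧ min |z 0| 1 ≤ b ∧ (|z 0| < 1 → |z 1| < 1 → b = |z 0|) := by
  obtain ⟨⟨h1, h2, h3⟩, h4, h5, h6, h7⟩ := hz
  obtain ⟨d, hd, hd1, hd2⟩ := tent_deriv _ h4 h5 h6 h7
  obtain ⟨c, hc, hc1⟩ := cut_deriv _ h1 h2 h3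
  have hcm := cut_mem (z 0)
  have hcd : min |z 0| 1 = 1 - cut (z 0) := by unfold cut; ring
  refine ⟨-(c * tent (z 1)), 1 - cut (z 0) * d, ?_, ?_, ?_, ?_, ?_⟩
  · rw [← hasFDerivWithinAt_univ, hasFDerivWithinAt_euclidean]
    simp only [hasFDerivWithinAt_univ]
    have p0 : HasFDerivAt (fun p : E2 => p 0) (EuclideanSpace.proj (𝕜 := ℝ) 0 : E2 →L[ℝ] ℝ) z :=
      (EuclideanSpace.proj (𝕜 := ℝ) 0 : E2 →L[ℝ] ℝ).hasFDerivAt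
    have p1 : HasFDerivAt (fun p : E2 => p 1) (EuclideanSpace.proj (𝕜 := ℝ) 1 : E2 →L[ℝ] ℝ) z :=
      (EuclideanSpace.proj (𝕜 := ℝ) 1 : E2 →L[ℝ] ℝ).hasFDerivAt
    intro i
    fin_cases i
    · simp only [Fin.zero_eta, ballMap_zero]
      refine p0.congr_fderiv ?_
      ext v
      simp [shear_zero]
    · simp only [Fin.mk_one, ballMap_one]
      refine (p1.sub ((hc.comp_hasFDerivAt z p0).mul (hd.comp_hasFDerivAt z p1))).congr_fderiv ?_
      ext v
      simp [shear_one]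
      ring
  · rw [abs_neg, abs_mul]
    exact mul_le_one₀ hc1 (abs_nonneg _) (tent_abs _)
  · rw [abs_le] at hd1; nlinarith
  · rw [abs_le] at hd1; rw [hcd]; nlinarith
  · intro hx hy
    rw [hd2 hy, mul_one, ← hcd, min_eq_left hx.le]

lemma lintegral_strip (g : ℝ → ℝ≥0∞) (hg : Measurable g) (S T : Set ℝ)
    (hS : MeasurableSet S) (hT : MeasurableSet T) :
    ∫⁻ z in {q : E2 | q 0 ∈ S ∧ q 1 ∈ T}, g (z 0) = (∫⁻ x in S, g x) * volume T := by
  have h1 := EuclideanSpace.volume_preserving_symm_measurableEquiv_toLp (Fin 2)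
  have h2 := volume_preserving_finTwoArrow ℝ
  have h3 := h2.comp h1
  have e := h3.setLIntegral_comp_preimage (s := S ×ˢ T) (f := fun z : ℝ × ℝ => g z.1)
    (hS.prod hT) (by fun_prop)
  have e2 : ∫⁻ z in S ×ˢ T, g z.1 = (∫⁻ x in S, g x) * volume T := by
    rw [Measure.volume_eq_prod, ← Measure.prod_restrict]
    have := lintegral_prod_mul (μ := (volume : Measure ℝ).restrict S)
      (ν := (volume : Measure ℝ).restrict T) (f := g) (g := fun _ => 1) hg.aemeasurable
      aemeasurable_const
    simpa using this
  rw [← e2, ← e]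
  rfl

lemma lintegral_inv_abs : ∫⁻ x in Ioo (-1 : ℝ) 1, ENNReal.ofReal (|x|⁻¹) = ⊤ := by
  by_contra hne
  have hint : IntegrableOn (fun x : ℝ => x⁻¹) (Ioo (-1) 1) := by
    refine ⟨by fun_prop, ?_⟩
    rw [hasFiniteIntegral_iff_norm]
    simpa [Real.norm_eq_abs] using lt_top_iff_ne_top.2 hne
  have h2 : IntervalIntegrable (fun x : ℝ => x⁻¹) volume (-1) 1 := by
    rw [intervalIntegrable_iff_integrableOn_Ioo_of_le (by norm_num)]
    exact hint
  rw [intervalIntegrable_inv_iff] at h2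
  norm_num [mem_uIcc] at h2

lemma lintegral_pow_lt_top (p R : ℝ) (hp0 : 0 < p) (hp : p < 1) (hR : 0 ≤ R) :
    ∫⁻ x in Icc (-R) R, ENNReal.ofReal ((6 + 6 * |x|⁻¹) ^ p) < ⊤ := by
  have h1 : IntervalIntegrable (fun x : ℝ => |x| ^ (-p)) volume (-R) R := by
    refine intervalIntegrable_of_even (by simp) fun x hx => ?_
    have := intervalIntegral.intervalIntegrable_rpow' (a := 0) (b := x) (r := -p) (by linarith)
    refine this.congr ?_
    intro t ht
    rw [uIoc_of_le hx.le] at ht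
    simp [abs_of_pos ht.1]
  have h2 : IntegrableOn (fun x : ℝ => 6 ^ p + 6 ^ p * |x| ^ (-p)) (Icc (-R) R) := by
    rw [← intervalIntegrable_iff_integrableOn_Icc_of_le (by linarith)]
    exact (intervalIntegrable_const).add (h1.const_mul _)
  refine lt_of_le_of_lt (lintegral_mono fun x => ?_) h2.lintegral_lt_top
  apply ENNReal.ofReal_le_ofReal
  have := NNReal.rpow_add_le_add_rpow 6 (6 * (Real.nnabs x)⁻¹) hp0.le hp.le
  have h3 : ((6 : ℝ) + 6 * |x|⁻¹) ^ p ≤ 6 ^ p + (6 * |x|⁻¹) ^ p := by exact_mod_cast this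
  rwa [Real.mul_rpow (by norm_num) (by positivity), Real.inv_rpow (abs_nonneg x),
    ← Real.rpow_neg (abs_nonneg x)] at h3

lemma tent_zero_iff {y : ℝ} : y - cut 0 * tent y = 0 ↔ y ∈ Icc (-1 : ℝ) 1 := by
  have : cut 0 = 1 := by simp [cut]
  rw [this, one_mul, mem_Icc]
  unfold tent
  grind

lemma ballMap_fiber : ballMap ⁻¹' {0} = {p : E2 | p 0 = 0 ∧ p 1 ∈ Icc (-1 : ℝ) 1} := by
  ext p
  simp only [mem_preimage, mem_singleton_iff, mem_ofPred_eq]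
  constructor
  · intro h
    have h0 : p 0 = 0 := by rw [← ballMap_zero, h]; rfl
    have h1 : ballMap p 1 = 0 := by rw [h]; rfl
    rw [ballMap_one, h0, tent_zero_iff] at h1
    exact ⟨h0, h1⟩
  · rintro ⟨h0, h1⟩
    ext i
    fin_cases i
    · simpa [ballMap_zero] using h0
    · simpa [ballMap_one, h0] using tent_zero_iff.2 h1

lemma vert_cont : Continuous (fun t : ℝ => (!₂[0, t] : E2)) := by fun_prop

lemma vert_zero : (!₂[0, 0] : E2) = 0 := by ext i; fin_cases i <;> rfl

lemma ballMap_acc : AccPt (0 : E2) (Filter.principal (ballMap ⁻¹' {0})) := by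
  rw [ballMap_fiber, accPt_iff_nhds]
  intro U hU
  have h := vert_cont.tendsto 0
  rw [vert_zero] at h
  have h1 : ∀ᶠ t in 𝓝[>] (0 : ℝ), (!₂[0, t] : E2) ∈ U :=
    (h.eventually_mem hU).filter_mono nhdsWithin_le_nhds
  obtain ⟨t, h1, h2⟩ := (h1.and (Ioo_mem_nhdsGT (zero_lt_one' ℝ))).exists
  refine ⟨_, ⟨h1, ?_⟩, ?_⟩
  · simp only [mem_ofPred_eq]
    exact ⟨rfl, by show (-1 : ℝ) ≤ t; linarith [h2.1], h2.2.le⟩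
  · intro h
    have : t = 0 := congrArg (fun v : E2 => v 1) h
    exact h2.1.ne' this

lemma ballMap_not_open : ¬ IsOpenMap ballMap := by
  intro ho
  have hU : IsOpen {p : E2 | p 1 ∈ Ioo (0 : ℝ) 1} :=
    isOpen_Ioo.preimage (by fun_prop : Continuous fun p : E2 => p 1)
  have hV := ho _ hU
  have h0 : (0 : E2) ∈ ballMap '' {p : E2 | p 1 ∈ Ioo (0 : ℝ) 1} := by
    refine ⟨!₂[0, 1/2], ?_, ?_⟩
    · show (1/2 : ℝ) ∈ Ioo (0 : ℝ) 1
      norm_num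
    · have : (!₂[0, 1/2] : E2) ∈ ballMap ⁻¹' {0} := by
        rw [ballMap_fiber]
        refine ⟨rfl, ?_⟩
        show (1/2 : ℝ) ∈ Icc (-1 : ℝ) 1
        norm_num
      exact this
  have h := vert_cont.tendsto 0
  rw [vert_zero] at h
  have h1 : ∀ᶠ t in 𝓝[>] (0 : ℝ), (!₂[0, t] : E2) ∈ ballMap '' {p : E2 | p 1 ∈ Ioo (0 : ℝ) 1} :=
    (h.eventually_mem (hV.mem_nhds h0)).filter_mono nhdsWithin_le_nhds
  obtain ⟨t, ⟨q, hq, hqt⟩, h2⟩ := (h1.and self_mem_nhdsWithin).exists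
  have e0 : q 0 = 0 := by rw [← ballMap_zero, hqt]; rfl
  have e1 : q 1 - cut (q 0) * tent (q 1) = t := by rw [← ballMap_one, hqt]; rfl
  rw [e0, tent_zero_iff.2 ⟨by linarith [hq.1], hq.2.le⟩] at e1
  exact (ne_of_gt h2) e1.symm

lemma ballMap_K (z : E2) (hz : good z) :
    ‖fderiv ℝ ballMap z‖ ^ 2 ≤ (6 + 6 * |z 0|⁻¹) * (fderiv ℝ ballMap z).det := by
  obtain ⟨a, b, h, ha, hb, hb', -⟩ := ballMap_deriv z hz
  rw [h.fderiv, shear_det]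
  refine (shear_norm_le a b).trans ?_
  have hx : 0 < |z 0| := abs_pos.2 hz.1.1
  have hb0 : 0 ≤ b := (le_min hx.le zero_le_one).trans hb'
  have ha2 : a ^ 2 ≤ 1 := by rw [← sq_abs]; exact pow_le_one₀ (abs_nonneg _) ha
  have hi := inv_pos.2 hx
  have key : 6 ≤ (6 + 6 * |z 0|⁻¹) * b := by
    rcases le_total |z 0| 1 with h1 | h1
    · rw [min_eq_left h1] at hb'
      have : 1 ≤ |z 0|⁻¹ * b := by
        rw [← inv_mul_cancel₀ hx.ne']; gcongr
      nlinarith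
    · rw [min_eq_right h1] at hb'
      nlinarith
  nlinarith

lemma ballMap_K_lower (K : E2 → ℝ)
    (hK : ∀ᵐ z : E2, ‖fderiv ℝ ballMap z‖ ^ 2 ≤ K z * (fderiv ℝ ballMap z).det) :
    ∫⁻ z in {q : E2 | q 0 ∈ Ioo (-1 : ℝ) 1 ∧ q 1 ∈ Ioo (-1 : ℝ) 1}, ENNReal.ofReal (K z) = ⊤ := by
  have h := lintegral_strip (fun x => ENNReal.ofReal (|x|⁻¹)) (by fun_prop) (Ioo (-1 : ℝ) 1)
    (Ioo (-1 : ℝ) 1) measurableSet_Ioo measurableSet_Ioo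
  rw [lintegral_inv_abs, ENNReal.top_mul (by simp)] at h
  rw [eq_top_iff, ← h]
  have hm : MeasurableSet {q : E2 | q 0 ∈ Ioo (-1 : ℝ) 1 ∧ q 1 ∈ Ioo (-1 : ℝ) 1} := by
    measurability
  refine setLIntegral_mono_ae' hm ?_
  filter_upwards [hK, ae_good] with z hz hg hmem
  apply ENNReal.ofReal_le_ofReal
  obtain ⟨a, b, hd, -, -, -, hb⟩ := ballMap_deriv z hg
  rw [hd.fderiv, shear_det, hb (abs_lt.2 hmem.1) (abs_lt.2 hmem.2)] at hz
  have hx : 0 < |z 0| := abs_pos.2 hg.1.1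
  have h1 : 1 ≤ ‖shear a |z 0|‖ ^ 2 := one_le_pow₀ (one_le_shear_norm a _)
  rw [inv_le_iff_one_le_mul₀ hx]
  linarith

lemma ballMap_K_pow (p : ℝ) (hp0 : 0 < p) (hp : p < 1) (A : Set E2) (hA : IsCompact A) :
    ∫⁻ z in A, ENNReal.ofReal ((6 + 6 * |z 0|⁻¹) ^ p) < ⊤ := by
  obtain ⟨R, hR0, hR⟩ := hA.isBounded.exists_pos_norm_le
  have hsub : A ⊆ {q : E2 | q 0 ∈ Icc (-R) R ∧ q 1 ∈ Icc (-R) R} := by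
    intro q hq
    have h0 := (PiLp.norm_apply_le q 0).trans (hR q hq)
    have h1 := (PiLp.norm_apply_le q 1).trans (hR q hq)
    exact ⟨abs_le.1 h0, abs_le.1 h1⟩
  refine (lintegral_mono_set hsub).trans_lt ?_
  rw [lintegral_strip (fun x => ENNReal.ofReal ((6 + 6 * |x|⁻¹) ^ p)) (by fun_prop) _ _
    measurableSet_Icc measurableSet_Icc]
  exact ENNReal.mul_lt_top (lintegral_pow_lt_top p R hp0 hp hR0.le) (by simp)

/-- **Sharpness of the integrability condition `K ∈ L¹_loc` (Ball's example).**
Ball's map `f₀` is Lipschitz (hence differentiable a.e.), its fiber over the origin is the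
nondegenerate segment `{0} × [−1,1]` (so `f₀` is not discrete and not open); it admits a
measurable distortion function `K ≥ 1` with `‖Df₀‖² ≤ K · det Df₀` a.e. and `K^p`
integrable on compacts for every `0 < p < 1`; yet every such distortion function fails
to be integrable on `(−1,1) × (−1,1)`. -/
theorem ball_map_sharpness
    (η : ℝ → ℝ → ℝ)
    (hη : ∀ x y : ℝ, η x y =
      if |x| ≤ 1 ∧ |y| ≤ 1 then |x| * y
      else if |x| ≤ 1 ∧ |y| ≤ 2 then (2 * (|y| - 1) + |x| * (2 - |y|)) * Real.sign y
      else y)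
    (f₀ : E2 → E2)
    (hf₀ : ∀ p : E2, f₀ p =
      (EuclideanSpace.equiv (Fin 2) ℝ).symm ![p 0, η (p 0) (p 1)]) :
    (∃ C : ℝ≥0, LipschitzWith C f₀) ∧
    (∀ᵐ z : E2, DifferentiableAt ℝ f₀ z) ∧
    (f₀ ⁻¹' {0} = {p : E2 | p 0 = 0 ∧ p 1 ∈ Icc (-1 : ℝ) 1}) ∧
    (∃ y x : E2, AccPt x (Filter.principal (f₀ ⁻¹' {y}))) ∧
    ¬ IsOpenMap f₀ ∧
    (∃ K : E2 → ℝ, Measurable K ∧ (∀ z, 1 ≤ K z) ∧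
      (∀ᵐ z : E2, ‖fderiv ℝ f₀ z‖ ^ 2 ≤ K z * (fderiv ℝ f₀ z).det) ∧
      (∀ p : ℝ, 0 < p → p < 1 → ∀ A : Set E2, IsCompact A →
        ∫⁻ z in A, ENNReal.ofReal (K z ^ p) < ⊤)) ∧
    (∀ K : E2 → ℝ, Measurable K →
      (∀ᵐ z : E2, ‖fderiv ℝ f₀ z‖ ^ 2 ≤ K z * (fderiv ℝ f₀ z).det) →
      ∫⁻ z in {q : E2 | q 0 ∈ Ioo (-1 : ℝ) 1 ∧ q 1 ∈ Ioo (-1 : ℝ) 1},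
        ENNReal.ofReal (K z) = ⊤) := by
  have hf : f₀ = ballMap := by
    funext p
    rw [hf₀, hη, eta_eq]
    rfl
  subst hf
  refine ⟨⟨4, ballMap_lip⟩, ?_, ballMap_fiber, ⟨0, 0, ballMap_acc⟩, ballMap_not_open,
    ⟨fun z => 6 + 6 * |z 0|⁻¹, by fun_prop, fun z => ?_, ?_, ballMap_K_pow⟩,
    fun K _ hK => ballMap_K_lower K hK⟩
  · filter_upwards [ae_good] with z hz
    obtain ⟨a, b, h, -⟩ := ballMap_deriv z hz
    exact h.differentiableAt
  · have : 0 ≤ |z 0|⁻¹ := by positivity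
    linarith
  · filter_upwards [ae_good] with z hz using ballMap_K z hz
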